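/- With the setup below, the diagonal entries of b satisfy, for every 1 ≤ j ≤ n: b_{n+1−j, n+1−j} = d_{jj} · (∏_{1≤m≤N, i_m = j−1} z_m) / (∏_{1≤m≤N, i_m = j} z_m), where empty products equal 1. -/

import Mathlib

open Matrix

/-- `yMat n 𝕂 i z` is the n×n identity matrix except entry (i+1, i) (1-based) equals `z`. -/
def yMat (n : ℕ) (𝕂 : Type*) [Field 𝕂] (i : ℕ) (z : 𝕂) :
    Matrix (Fin n) (Fin n) 𝕂 :=
  fun a b => if a = b then 1 else if (a : ℕ) = i ∧ (b : ℕ) + 1 = i then z else 0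

/-- `xMat n 𝕂 i z` is the n×n identity matrix except entry (i, i+1) (1-based) equals `z`. -/
def xMat (n : ℕ) (𝕂 : Type*) [Field 𝕂] (i : ℕ) (z : 𝕂) :
    Matrix (Fin n) (Fin n) 𝕂 :=
  fun a b => if a = b then 1 else if (a : ℕ) + 1 = i ∧ (b : ℕ) = i then z else 0

/-- `xNegMat n 𝕂 i z` is the identity except the 2×2 block in rows/cols i, i+1 (1-based)
equals [[z⁻¹, 0], [1, z]]. -/
noncomputable def xNegMat (n : ℕ) (𝕂 : Type*) [Field 𝕂] (i : ℕ) (z : 𝕂) :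
    Matrix (Fin n) (Fin n) 𝕂 :=
  fun a b =>
    if (a : ℕ) + 1 = i ∧ (b : ℕ) + 1 = i then z⁻¹
    else if (a : ℕ) = i ∧ (b : ℕ) = i then z
    else if (a : ℕ) = i ∧ (b : ℕ) + 1 = i then 1
    else if a = b then 1 else 0

/-- The matrix w̄₀ with (i, n+1−i) entry (−1)^(n−i) (1-based) and other entries 0. -/
def w0bar (n : ℕ) (𝕂 : Type*) [Field 𝕂] : Matrix (Fin n) (Fin n) 𝕂 :=
  fun a b => if (a : ℕ) + (b : ℕ) = n - 1 then (-1 : 𝕂) ^ (n - 1 - (a : ℕ)) else 0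

/-- s_k = Σ_{j=1}^{k−1} (n−j). -/
def sIdx (n k : ℕ) : ℕ := ∑ j ∈ Finset.Icc 1 (k - 1), (n - j)

/-- The word 𝐢₀ = (1,2,…,n−1, 1,2,…,n−2, …, 1,2, 1). -/
def wordI0 (n : ℕ) : List ℕ :=
  (List.range (n - 1)).flatMap (fun k => (List.range (n - 1 - k)).map (· + 1))

/-- The word 𝐢′₀ = (n−1,…,1, n−1,…,2, …, n−1,n−2, n−1). -/
def wordI0' (n : ℕ) : List ℕ :=
  (List.range (n - 1)).flatMap (fun k => (List.range (n - 1 - k)).map (fun a => n - 1 - a))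

/-- The simple reflection s_i = (i, i+1) (1-based) as a permutation of `Fin n`. -/
def sPerm (n i : ℕ) : Equiv.Perm (Fin n) :=
  if h : 1 ≤ i ∧ i < n then Equiv.swap ⟨i - 1, by omega⟩ ⟨i, h.2⟩ else 1

/-- The longest element of S_n, k ↦ n+1−k (1-based). -/
def w0Perm (n : ℕ) : Equiv.Perm (Fin n) where
  toFun a := ⟨n - 1 - (a : ℕ), by have := a.isLt; omega⟩
  invFun a := ⟨n - 1 - (a : ℕ), by have := a.isLt; omega⟩
  left_inv a := by
    have := a.isLt
    apply Fin.ext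
    show n - 1 - (n - 1 - (a : ℕ)) = (a : ℕ)
    omega
  right_inv a := by
    have := a.isLt
    apply Fin.ext
    show n - 1 - (n - 1 - (a : ℕ)) = (a : ℕ)
    omega

/-- Apply a permutation of `Fin n` to a 1-based label in {1, …, n}. -/
def permApp {n : ℕ} (σ : Equiv.Perm (Fin n)) (x : ℕ) : ℕ :=
  if h : 1 ≤ x ∧ x ≤ n then ((σ ⟨x - 1, by omega⟩ : Fin n) : ℕ) + 1 else x


/-- Right multiplication of a row vector, indexed by `ℕ`, by `xNegMat n 𝕂 i z`. -/
noncomputable def rowAct {𝕂 : Type*} [Field 𝕂] (i : ℕ) (z : 𝕂) (f : ℕ → 𝕂) : ℕ → 𝕂 :=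
  fun j => if j + 1 = i then f j * z⁻¹ + f (j + 1) else if j = i then f j * z else f j

/-- Successive right multiplication of a row vector by the `xNegMat n 𝕂 i z`, with `i` running
through a word and `z` through a sequence. -/
noncomputable def rowActs {𝕂 : Type*} [Field 𝕂] : List ℕ → (ℕ → 𝕂) → (ℕ → 𝕂) → ℕ → 𝕂
  | [], _, f => f
  | i :: w, z, f => rowActs w (fun t => z (t + 1)) (rowAct i (z 0) f)

/-- The sequence `1, z 0, z 1, …`. -/
def shiftOne {𝕂 : Type*} [Field 𝕂] (z : ℕ → 𝕂) : ℕ → 𝕂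
  | 0 => 1
  | j + 1 => z j

section RowAction

variable {𝕂 : Type*} [Field 𝕂]

theorem vecMul_xNegMat {n i : ℕ} (hi : 1 ≤ i) (hin : i < n) (z : 𝕂) (f : ℕ → 𝕂) :
    (fun a : Fin n => f a) ᵥ* xNegMat n 𝕂 i z = fun a : Fin n => rowAct i z f a := by
  obtain ⟨i, rfl⟩ : ∃ k, i = k + 1 := ⟨i - 1, by omega⟩
  ext b
  simp only [vecMul, dotProduct, xNegMat, rowAct]
  by_cases h1 : (b : ℕ) = i
  · have hne : b ≠ ⟨i + 1, hin⟩ := by intro h; simp [h] at h1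
    rw [Fintype.sum_eq_add b ⟨i + 1, hin⟩ hne]
    · simp [h1]
    · rintro x ⟨hx1, hx2⟩
      simp only [ne_eq, Fin.ext_iff] at hx1 hx2
      have h3 : ¬ (x : ℕ) = i := by omega
      simp [h1, h3, hx2, Fin.ext_iff]
  · rw [Fintype.sum_eq_single b]
    · by_cases h2 : (b : ℕ) = i + 1 <;> simp [h1, h2]
    · intro x hx
      simp [h1, hx]
      intro h2 h3
      exact absurd (Fin.ext (h2.trans h3.symm)) hx

theorem rowActs_append (w₁ w₂ : List ℕ) (z f : ℕ → 𝕂) :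
    rowActs (w₁ ++ w₂) z f = rowActs w₂ (fun t => z (t + w₁.length)) (rowActs w₁ z f) := by
  induction w₁ generalizing z f with
  | nil => rfl
  | cons i w ih => simp [rowActs, ih, add_assoc]

theorem vecMul_prod_xNegMat {n : ℕ} (w : List ℕ) (hw : ∀ i ∈ w, 1 ≤ i ∧ i < n) (z f : ℕ → 𝕂) :
    (fun a : Fin n => f a) ᵥ*
        ((List.range w.length).map (fun t => xNegMat n 𝕂 (w.getD t 0) (z t))).prod =
      fun a : Fin n => rowActs w z f a := by
  induction w generalizing z f with
  | nil => simp [rowActs]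
  | cons i w ih =>
    have hi := hw i (by simp)
    rw [List.length_cons, List.range_succ_eq_map, List.map_cons, List.prod_cons,
      ← vecMul_vecMul, List.map_map]
    simp only [List.getD_cons_zero, vecMul_xNegMat hi.1 hi.2]
    exact ih (fun k hk => hw k (by simp [hk])) (fun t => z (t + 1)) _

theorem rowActs_of_lt {m : ℕ} (w : List ℕ) (hw : ∀ i ∈ w, i ≤ m) (z f : ℕ → 𝕂) {j : ℕ}
    (hj : m < j) : rowActs w z f j = f j := by
  induction w generalizing z f with
  | nil => rfl
  | cons i w ih =>
    have hi := hw i (by simp)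
    rw [rowActs, ih (fun k hk => hw k (by simp [hk])), rowAct, if_neg (by omega),
      if_neg (by omega)]

theorem rowActs_congr {m : ℕ} (w : List ℕ) (hw : ∀ i ∈ w, i ≤ m) (z : ℕ → 𝕂) {f g : ℕ → 𝕂}
    (h : ∀ j ≤ m, f j = g j) : ∀ j ≤ m, rowActs w z f j = rowActs w z g j := by
  induction w generalizing z f g with
  | nil => exact h
  | cons i w ih =>
    have hi := hw i (by simp)
    refine ih (fun k hk => hw k (by simp [hk])) _ fun j hj => ?_
    rw [rowAct, rowAct, h j hj]
    split_ifs with h1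
    · rw [h (j + 1) (by omega)]
    · rfl
    · rfl

theorem rowActs_zero (w : List ℕ) (z : ℕ → 𝕂) : rowActs w z 0 = 0 := by
  induction w generalizing z with
  | nil => rfl
  | cons i w ih =>
    have : rowAct i (z 0) 0 = 0 := by ext j; simp [rowAct]
    rw [rowActs, this, ih]

theorem rowActs_range (m : ℕ) (z f : ℕ → 𝕂) (j : ℕ) :
    rowActs ((List.range m).map (· + 1)) z f j =
      if j < m then f j * shiftOne z j * (z j)⁻¹ + f (j + 1)
      else if j = m then f j * shiftOne z j else f j := by
  induction m generalizing j with
  | zero =>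
    rcases j with _ | j <;> simp [rowActs, shiftOne]
  | succ m ih =>
    rw [List.range_succ, List.map_append, rowActs_append]
    simp only [List.map_cons, List.map_nil, rowActs, rowAct, ih, List.length_map,
      List.length_range, zero_add]
    rcases lt_trichotomy j m with h | rfl | h
    · have h1 : j ≠ m := by omega
      have h2 : j ≠ m + 1 := by omega
      have h3 : j < m + 1 := by omega
      simp [h, h1, h2, h3]
    · simp
    · have h1 : j ≠ m := by omega
      have h0 : ¬ j < m := by omega
      have h3 : ¬ j < m + 1 := by omega
      by_cases h2 : j = m + 1
      · subst h2; simp [shiftOne]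
      · simp [h0, h1, h2, h3]

theorem wordI0_succ_succ (m : ℕ) :
    wordI0 (m + 2) = (List.range (m + 1)).map (· + 1) ++ wordI0 (m + 1) := by
  simp only [wordI0, Nat.add_sub_cancel, show m + 2 - 1 = m + 1 from rfl]
  rw [List.range_succ_eq_map, List.flatMap_cons, List.flatMap_map, ← List.range_succ_eq_map]
  simp [Nat.add_sub_add_right]

theorem mem_wordI0 {n i : ℕ} (h : i ∈ wordI0 n) : 1 ≤ i ∧ i < n := by
  simp only [wordI0, List.mem_flatMap, List.mem_range, List.mem_map] at h
  obtain ⟨k, hk, a, ha, rfl⟩ := h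
  omega

theorem length_wordI0 (m : ℕ) : (wordI0 (m + 1)).length = (m + 1) * m / 2 := by
  rw [show (m + 1) * m / 2 = (m + 1).choose 2 from (Nat.choose_two_right (m + 1)).symm]
  induction m with
  | zero => rfl
  | succ m ih =>
    rw [wordI0_succ_succ, List.length_append, ih, Nat.choose_succ_succ' (m + 1) 1]
    simp

/-- The matrix of the word `wordI0 (m + 1)` lies in `N * w0bar * N`, with `N` the group of upper
unitriangular matrices: row operations by `N` bring it to anti-triangular form. -/
theorem exists_rowActs_wordI0 (m : ℕ) (z : ℕ → 𝕂)
    (hz : ∀ t < (wordI0 (m + 1)).length, z t ≠ 0) (r : ℕ) (hr : r ≤ m) :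
    ∃ v : ℕ → 𝕂, v r = 1 ∧ (∀ j < r, v j = 0) ∧
      rowActs (wordI0 (m + 1)) z v (m - r) = (-1) ^ (m - r) ∧
      ∀ j < m - r, rowActs (wordI0 (m + 1)) z v j = 0 := by
  induction m generalizing z r with
  | zero =>
    obtain rfl : r = 0 := by omega
    exact ⟨fun _ => 1, by simp [wordI0, rowActs]⟩
  | succ m ih =>
    have hlen : (wordI0 (m + 1 + 1)).length = m + 1 + (wordI0 (m + 1)).length := by
      simp [wordI0_succ_succ]
    have hw : ∀ i ∈ wordI0 (m + 1), i ≤ m := fun i hi => by have := mem_wordI0 hi; omega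
    rw [show m + 1 + 1 = m + 2 from rfl, wordI0_succ_succ]
    simp only [rowActs_append, List.length_map, List.length_range]
    set z' : ℕ → 𝕂 := fun t => z (t + (m + 1))
    rcases r with _ | s
    · have hp : ∀ j ≤ m + 1, shiftOne z j ≠ 0 := by
        rintro (_ | j) hj
        · simp [shiftOne]
        · exact hz j (by omega)
      refine ⟨fun j => (-1) ^ j * (shiftOne z j)⁻¹, by simp [shiftOne], by simp, ?_, ?_⟩
      · rw [rowActs_of_lt _ hw _ _ (by omega), rowActs_range]
        simp [hp (m + 1) le_rfl]
      · intro j hj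
        rw [rowActs_congr (g := 0) _ hw _ _ j (by omega), rowActs_zero, Pi.zero_apply]
        intro j hj
        rw [rowActs_range, if_pos (by omega), inv_mul_cancel_right₀ (hp j (by omega))]
        simp [shiftOne, pow_succ]
    · obtain ⟨v', h1, h2, h3, h4⟩ := ih z' (fun t ht => hz _ (by omega)) s (by omega)
      let v : ℕ → 𝕂 := fun j => Nat.rec 0 (fun j x => v' j - x * shiftOne z j * (z j)⁻¹) j
      have hv : ∀ j, v (j + 1) = v' j - v j * shiftOne z j * (z j)⁻¹ := fun j => rfl
      have hv0 : ∀ j ≤ s, v j = 0 := by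
        intro j
        induction j with
        | zero => intro _; rfl
        | succ j ihj => intro hj; rw [hv, ihj (by omega), h2 j (by omega)]; simp
      have hc : ∀ j ≤ m, rowActs (wordI0 (m + 1)) z'
          (rowActs ((List.range (m + 1)).map (· + 1)) z v) j =
            rowActs (wordI0 (m + 1)) z' v' j := by
        refine rowActs_congr _ hw _ fun j hj => ?_
        rw [rowActs_range, if_pos (by omega), hv]
        ring
      rw [Nat.add_sub_add_right]
      refine ⟨v, by rw [hv, hv0 s le_rfl, h1]; simp, fun j hj => hv0 j (by omega), ?_, ?_⟩
      · rw [hc _ (by omega), h3]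
      · intro j hj
        rw [hc _ (by omega), h4 j hj]

end RowAction

section Triangular

variable {𝕂 : Type*} [Field 𝕂] {n : ℕ}

theorem upper_mul {A B : Matrix (Fin n) (Fin n) 𝕂} (hA : ∀ a b, b < a → A a b = 0)
    (hB : ∀ a b, b < a → B a b = 0) :
    (∀ a b, b < a → (A * B) a b = 0) ∧ ∀ a, (A * B) a a = A a a * B a a := by
  refine ⟨fun a b hab => ?_, fun a => ?_⟩
  · rw [mul_apply]
    refine Finset.sum_eq_zero fun c _ => ?_
    rcases lt_or_ge c a with h | h
    · rw [hA a c h, zero_mul]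
    · rw [hB c b (hab.trans_le h), mul_zero]
  · rw [mul_apply]
    refine Finset.sum_eq_single a (fun c _ hc => ?_) (by simp)
    rcases lt_or_gt_of_ne hc with h | h
    · rw [hA a c h, zero_mul]
    · rw [hB c a h, mul_zero]

theorem lower_mul {A B : Matrix (Fin n) (Fin n) 𝕂} (hA : ∀ a b, a < b → A a b = 0)
    (hB : ∀ a b, a < b → B a b = 0) :
    (∀ a b, a < b → (A * B) a b = 0) ∧ ∀ a, (A * B) a a = A a a * B a a := by
  have h := upper_mul (A := Bᵀ) (B := Aᵀ) (fun a b => hB b a) (fun a b => hA b a)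
  rw [← transpose_mul] at h
  exact ⟨fun a b hab => h.1 b a hab, fun a => (h.2 a).trans (mul_comm _ _)⟩

theorem exists_inv_upper {A : Matrix (Fin n) (Fin n) 𝕂} (hA : ∀ a b, b < a → A a b = 0)
    (hA1 : ∀ a, A a a = 1) :
    ∃ B : Matrix (Fin n) (Fin n) 𝕂, (∀ a b, b < a → B a b = 0) ∧ (∀ a, B a a = 1) ∧
      A * B = 1 ∧ B * A = 1 := by
  have hT : A.BlockTriangular id := fun a b h => hA a b h
  have hdet : IsUnit A.det := by simp [det_of_isUpperTriangular hT, hA1]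
  have := A.invertibleOfIsUnitDet hdet
  have hB : ∀ a b, b < a → A⁻¹ a b = 0 := fun a b h => blockTriangular_inv_of_blockTriangular hT h
  refine ⟨A⁻¹, hB, fun a => ?_, A.mul_nonsing_inv hdet, A.nonsing_inv_mul hdet⟩
  have h := (upper_mul hA hB).2 a
  rw [A.mul_nonsing_inv hdet, hA1] at h
  simpa using h.symm

theorem w0bar_apply (a b : Fin n) :
    w0bar n 𝕂 a b = if b = a.rev then (-1) ^ (b : ℕ) else 0 := by
  have h : ((a : ℕ) + b = n - 1) ↔ b = a.rev := by
    simp only [Fin.ext_iff, Fin.val_rev]; omega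
  simp only [w0bar, h]
  split_ifs with hb
  · rw [hb, Fin.val_rev, Nat.sub_sub, Nat.add_comm 1]
  · rfl

theorem w0bar_mul_apply (X : Matrix (Fin n) (Fin n) 𝕂) (a b : Fin n) :
    (w0bar n 𝕂 * X) a b = (-1) ^ (a.rev : ℕ) * X a.rev b := by
  simp [mul_apply, w0bar_apply]

theorem mul_w0bar_apply (X : Matrix (Fin n) (Fin n) 𝕂) (a b : Fin n) :
    (X * w0bar n 𝕂) a b = (-1) ^ (b : ℕ) * X a b.rev := by
  simp only [mul_apply, w0bar_apply]
  rw [Finset.sum_eq_single b.rev]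
  · simp [mul_comm]
  · intro c _ hc
    rw [if_neg, mul_zero]
    rintro rfl
    simp at hc
  · simp

theorem w0bar_transpose_mul_apply (X : Matrix (Fin n) (Fin n) 𝕂) (a b : Fin n) :
    ((w0bar n 𝕂)ᵀ * X) a b = (-1) ^ (a : ℕ) * X a.rev b := by
  have h : (w0bar n 𝕂)ᵀ * X = (Xᵀ * w0bar n 𝕂)ᵀ := by rw [transpose_mul, transpose_transpose]
  rw [h, transpose_apply, mul_w0bar_apply, transpose_apply]

theorem mul_w0bar_transpose_apply (X : Matrix (Fin n) (Fin n) 𝕂) (a b : Fin n) :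
    (X * (w0bar n 𝕂)ᵀ) a b = (-1) ^ (b.rev : ℕ) * X a b.rev := by
  have h : X * (w0bar n 𝕂)ᵀ = (w0bar n 𝕂 * Xᵀ)ᵀ := by rw [transpose_mul, transpose_transpose]
  rw [h, transpose_apply, w0bar_mul_apply, transpose_apply]

theorem neg_one_pow_mul_cancel (k : ℕ) (x : 𝕂) : (-1) ^ k * ((-1) ^ k * x) = x := by
  rw [← mul_assoc, ← mul_pow]; simp

theorem w0bar_transpose_mul_self : (w0bar n 𝕂)ᵀ * w0bar n 𝕂 = 1 := by
  ext a b
  rw [w0bar_transpose_mul_apply, w0bar_apply, Fin.rev_rev, one_apply]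
  split_ifs with h1 h2 h2
  · rw [h1, ← mul_pow]; simp
  · exact absurd h1.symm h2
  · exact absurd h2.symm h1
  · simp

theorem w0bar_mul_transpose_self : w0bar n 𝕂 * (w0bar n 𝕂)ᵀ = 1 :=
  mul_eq_one_comm.mp w0bar_transpose_mul_self

theorem w0bar_mul_mul_w0bar (X : Matrix (Fin n) (Fin n) 𝕂) :
    w0bar n 𝕂 * (X * (w0bar n 𝕂)ᵀ) * (w0bar n 𝕂)ᵀ = (w0bar n 𝕂)ᵀ * X := by
  ext a b
  rw [mul_w0bar_transpose_apply, w0bar_mul_apply, mul_w0bar_transpose_apply, Fin.rev_rev,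
    w0bar_transpose_mul_apply]
  have h : (-1 : 𝕂) ^ (b.rev : ℕ) * (-1) ^ (b : ℕ) = (-1) ^ (a.rev : ℕ) * (-1) ^ (a : ℕ) := by
    rw [← pow_add, ← pow_add]
    congr 1
    simp only [Fin.val_rev]; omega
  linear_combination (-1) ^ (a.rev : ℕ) * X a.rev b * h +
    neg_one_pow_mul_cancel (a.rev : ℕ) ((-1 : 𝕂) ^ (a : ℕ) * X a.rev b)

/-- If `A * B = C` with `B` and `C` upper unitriangular, then `A` has unit diagonal. -/
theorem diag_eq_one_of_mul_upper {A B C : Matrix (Fin n) (Fin n) 𝕂}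
    (hB : ∀ a b, b < a → B a b = 0) (hB1 : ∀ a, B a a = 1)
    (hC : ∀ a b, b < a → C a b = 0) (hC1 : ∀ a, C a a = 1) (h : A * B = C) (a : Fin n) :
    A a a = 1 := by
  obtain ⟨B', hB', hB'1, hBB', -⟩ := exists_inv_upper hB hB1
  have hA : A = C * B' := by rw [← h, Matrix.mul_assoc, hBB', Matrix.mul_one]
  rw [hA, (upper_mul hC hB').2, hC1, hB'1, one_mul]

theorem xNegMat_lower (i : ℕ) (z : 𝕂) (a b : Fin n) (hab : a < b) :
    xNegMat n 𝕂 i z a b = 0 := by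
  have h : (a : ℕ) < b := hab
  rw [xNegMat, if_neg (by omega), if_neg (by omega), if_neg (by omega), if_neg hab.ne]

theorem xNegMat_diag (i : ℕ) (z : 𝕂) (a : Fin n) :
    xNegMat n 𝕂 i z a a = (if i = a then z else 1) * (if i = a + 1 then z else 1)⁻¹ := by
  rcases eq_or_ne i (a : ℕ) with rfl | h1
  · simp [xNegMat]
  · rcases eq_or_ne i ((a : ℕ) + 1) with rfl | h2
    · simp [xNegMat]
    · simp [xNegMat, h1, h2, h1.symm, h2.symm]

theorem lower_list_prod (F : ℕ → Matrix (Fin n) (Fin n) 𝕂)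
    (hF : ∀ t a b, a < b → F t a b = 0) (N : ℕ) :
    (∀ a b, a < b → ((List.range N).map F).prod a b = 0) ∧
      ∀ a, ((List.range N).map F).prod a a = ∏ t ∈ Finset.range N, F t a a := by
  induction N with
  | zero => exact ⟨fun a b h => by simp [h.ne], fun a => by simp⟩
  | succ N ih =>
    rw [List.range_succ, List.map_append, List.prod_append, List.map_singleton,
      List.prod_singleton]
    have h := lower_mul ih.1 (hF N)
    exact ⟨h.1, fun a => by rw [h.2, ih.2, Finset.prod_range_succ]⟩

theorem prod_Icc_filter_getD (w : List ℕ) (z : ℕ → 𝕂) (N k : ℕ) :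
    ∏ m ∈ (Finset.Icc 1 N).filter (fun m => w.getD (m - 1) 0 = k), z m =
      ∏ t ∈ Finset.range N, if w.getD t 0 = k then z (t + 1) else 1 := by
  have h := Finset.prod_Ico_add' (fun m => if w.getD (m - 1) 0 = k then z m else 1) 0 N 1
  simp only [Nat.add_sub_cancel] at h
  rw [Finset.prod_filter, Finset.range_eq_Ico, h]
  rfl

end Triangular

/-- the diagonal entries of b are given by
b_{n+1−j,n+1−j} = d_{jj} · (∏_{i_m = j−1} z_m) / (∏_{i_m = j} z_m). -/
theorem stmt4
    (𝕂 : Type*) [Field 𝕂]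
    (n N : ℕ) (hn : 2 ≤ n) (hN : N = n * (n - 1) / 2)
    (z : ℕ → 𝕂) (hz : ∀ j, 1 ≤ j → j ≤ N → z j ≠ 0)
    (u : Matrix (Fin n) (Fin n) 𝕂)
    (hu : u = ((List.range N).map
      (fun t => xNegMat n 𝕂 ((wordI0 n).getD t 0) (z (t + 1)))).prod)
    (L D U : Matrix (Fin n) (Fin n) 𝕂)
    (hL : ∀ a b : Fin n, a < b → L a b = 0) (hLdiag : ∀ a : Fin n, L a a = 1)
    (hD : ∀ a b : Fin n, a ≠ b → D a b = 0) (hDinv : ∀ a : Fin n, D a a ≠ 0)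
    (hU : ∀ a b : Fin n, b < a → U a b = 0) (hUdiag : ∀ a : Fin n, U a a = 1)
    (hLDU : (w0bar n 𝕂 * u.transpose)⁻¹ = L * D * U)
    (u₁ : Matrix (Fin n) (Fin n) 𝕂)
    (hu₁ : u₁ = (w0bar n 𝕂 * U⁻¹ * (w0bar n 𝕂)⁻¹).transpose)
    (d : Matrix (Fin n) (Fin n) 𝕂)
    (hd : ∀ a b : Fin n, a ≠ b → d a b = 0) (hdinv : ∀ a : Fin n, d a a ≠ 0)
    (u₂ : Matrix (Fin n) (Fin n) 𝕂)
    (hu₂ : ∀ a b : Fin n, b < a → u₂ a b = 0) (hu₂diag : ∀ a : Fin n, u₂ a a = 1)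
    (b : Matrix (Fin n) (Fin n) 𝕂)
    (hb : b = u₁ * d * w0bar n 𝕂 * u₂)
    (hblower : ∀ p q : Fin n, p < q → b p q = 0)
    :
    ∀ j : Fin n, b j.rev j.rev =
      d j j *
        (∏ m ∈ (Finset.Icc 1 N).filter (fun m => (wordI0 n).getD (m - 1) 0 = (j : ℕ)), z m) /
        (∏ m ∈ (Finset.Icc 1 N).filter (fun m => (wordI0 n).getD (m - 1) 0 = (j : ℕ) + 1), z m) := by
  obtain ⟨m, rfl⟩ : ∃ m, n = m + 1 := ⟨n - 1, by omega⟩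
  have hlen : (wordI0 (m + 1)).length = N := by rw [length_wordI0, hN]; simp
  have hulow := lower_list_prod (fun t => xNegMat (m + 1) 𝕂 ((wordI0 (m + 1)).getD t 0) (z (t + 1)))
    (fun t => xNegMat_lower _ _) N
  rw [← hu] at hulow
  obtain ⟨hul, hudiag⟩ := hulow
  set w := w0bar (m + 1) 𝕂 with hw
  have hwT : wᵀ * w = 1 := w0bar_transpose_mul_self
  have hwT' : w * wᵀ = 1 := w0bar_mul_transpose_self
  -- An upper unitriangular `V` such that `V * u * wᵀ` is lower unitriangular.
  choose v hv1 hv0 hg1 hg0 using fun r : Fin (m + 1) =>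
    exists_rowActs_wordI0 m (fun t => z (t + 1))
      (fun t ht => hz _ (by omega) (by omega)) r (by omega)
  let V : Matrix (Fin (m + 1)) (Fin (m + 1)) 𝕂 := fun a c => v a c
  have hVu : ∀ a c : Fin (m + 1),
      (V * u) a c = rowActs (wordI0 (m + 1)) (fun t => z (t + 1)) (v a) c := fun a c => by
    rw [hu, ← hlen]
    exact congrFun (vecMul_prod_xNegMat (wordI0 (m + 1)) (fun i => mem_wordI0)
      (fun t => z (t + 1)) (v a)) c
  have hrev : ∀ a : Fin (m + 1), (a.rev : ℕ) = m - a := fun a => by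
    rw [Fin.val_rev]; omega
  have hMlow : ∀ a c : Fin (m + 1), a < c → (V * u * wᵀ) a c = 0 := fun a c hac => by
    have : (a : ℕ) < c := hac
    rw [mul_w0bar_transpose_apply, hVu, hg0 a _ (by rw [hrev]; omega), mul_zero]
  have hMdiag : ∀ a, (V * u * wᵀ) a a = 1 := fun a => by
    rw [mul_w0bar_transpose_apply, hVu, hrev, hg1, ← mul_pow]; simp
  -- The factorization forces `D = 1`.
  have hLU : IsUnit (L * D * U).det := by
    have h1 : L.det = 1 := by
      rw [det_of_isLowerTriangular L fun a c h => hL a c h]; simp [hLdiag]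
    have h2 : U.det = 1 := by
      rw [det_of_isUpperTriangular (M := U) fun a c h => hU a c h]; simp [hUdiag]
    have h3 : D.det ≠ 0 := by
      rw [det_of_isUpperTriangular (M := D) fun a c h => hD a c (ne_of_gt h)]
      exact Finset.prod_ne_zero_iff.mpr fun a _ => hDinv a
    simpa [det_mul, h1, h2] using h3
  have hinv : w * uᵀ * (L * D * U) = 1 := by
    rw [← hLDU] at hLU ⊢
    exact mul_nonsing_inv _ ((isUnit_nonsing_inv_det_iff).mp hLU)
  have hinv' : u * wᵀ * (Uᵀ * Dᵀ * Lᵀ) = 1 := by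
    rw [mul_eq_one_comm]
    have h := congrArg transpose hinv
    simpa only [transpose_mul, transpose_transpose, transpose_one, Matrix.mul_assoc] using h
  have hUD := lower_mul (A := Uᵀ) (B := Dᵀ) (fun a c h => hU c a h) (fun a c h => hD c a h.ne')
  have hMUD := lower_mul hMlow hUD.1
  have hD1 : D = 1 := by
    ext a c
    rcases eq_or_ne a c with rfl | hac
    · have h := diag_eq_one_of_mul_upper (A := V * u * wᵀ * (Uᵀ * Dᵀ))
        (B := Lᵀ) (C := V) (fun a c h => hL c a h)
        hLdiag (fun a c h => hv0 a c h) hv1 (by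
          calc V * u * wᵀ * (Uᵀ * Dᵀ) * Lᵀ = V * (u * wᵀ * (Uᵀ * Dᵀ * Lᵀ)) := by
                simp only [Matrix.mul_assoc]
            _ = V := by rw [hinv', Matrix.mul_one]) a
      rw [hMUD.2, hUD.2, hMdiag, transpose_apply, transpose_apply, hUdiag] at h
      simpa using h
    · rw [hD a c hac, one_apply_ne hac]
  have hUinv : U⁻¹ = w * uᵀ * L := by
    refine inv_eq_left_inv ?_
    rw [← hinv, hD1]
    simp only [Matrix.mul_assoc, Matrix.one_mul]
  have hb' : b = wᵀ * (Lᵀ * u) * d * w * u₂ := by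
    rw [hb, hu₁, hUinv, inv_eq_left_inv hwT, ← w0bar_mul_mul_w0bar]
    simp only [transpose_mul, transpose_transpose, Matrix.mul_assoc, ← hw]
  obtain ⟨K, hK, hK1, -, hKL⟩ := exists_inv_upper (A := Lᵀ) (fun a c h => hL c a h) hLdiag
  have hAb : wᵀ * K * w * b = wᵀ * (u * d) * w * u₂ := by
    calc wᵀ * K * w * b = wᵀ * K * (w * wᵀ) * Lᵀ * u * d * w * u₂ := by
          rw [hb']; simp only [Matrix.mul_assoc]
      _ = wᵀ * (K * Lᵀ) * (u * d) * w * u₂ := by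
          rw [hwT']; simp only [Matrix.mul_assoc, Matrix.one_mul]
      _ = _ := by rw [hKL, Matrix.mul_one]
  have hconj : ∀ (X : Matrix (Fin (m + 1)) (Fin (m + 1)) 𝕂) (a c),
      (wᵀ * X * w) a c = (-1) ^ (c : ℕ) * ((-1) ^ (a : ℕ) * X a.rev c.rev) := fun X a c => by
    rw [mul_w0bar_apply, w0bar_transpose_mul_apply]
  have hud := lower_mul hul (B := d) (fun a c h => hd a c h.ne)
  have hleft := lower_mul (A := wᵀ * K * w) (fun a c h => by
    rw [hconj, hK _ _ (Fin.rev_lt_rev.mpr h)]; simp) hblower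
  have hright := upper_mul (A := wᵀ * (u * d) * w) (fun a c h => by
    rw [hconj, hud.1 _ _ (Fin.rev_lt_rev.mpr h)]; simp) hu₂
  intro j
  have hj := hleft.2 j.rev
  rw [hAb, hright.2, hconj, hconj, neg_one_pow_mul_cancel, neg_one_pow_mul_cancel, hK1, hu₂diag,
    Fin.rev_rev, hud.2, mul_one, one_mul] at hj
  rw [← hj, hudiag, prod_Icc_filter_getD, prod_Icc_filter_getD]
  simp only [xNegMat_diag, Finset.prod_mul_distrib, Finset.prod_inv_distrib]
  rw [div_eq_mul_inv]
  ring
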